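/- A smooth vector field ζ^μ on ℝ^D satisfies D⁺_μ ζ_ν = 0 for all μ,ν if and only if both (ℒ_ζ G)_{μν} = 0 for all μ,ν and H_{μνρ} ζ^ρ = ∂_μ ζ_ν − ∂_ν ζ_μ for all μ,ν. Similarly, D⁻_μ ζ_ν = 0 for all μ,ν if and only if (ℒ_ζ G)_{μν} = 0 and H_{μνρ} ζ^ρ = −(∂_μ ζ_ν − ∂_ν ζ_μ) for all μ,ν. Equivalently: ζ is ±covariantly constant if and only if (ζ, b) with b_μ = ∓ζ_μ is a Killing pair. -/

import Mathlib

noncomputable section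

/-- Partial derivative of `f` at `x` in the `μ`-th coordinate direction. -/
def pd {D : ℕ} (μ : Fin D) (f : (Fin D → ℝ) → ℝ) (x : Fin D → ℝ) : ℝ :=
  fderiv ℝ f x (Pi.single μ 1)

/-- A smooth real-valued function. -/
def Sm {D : ℕ} (f : (Fin D → ℝ) → ℝ) : Prop := ContDiff ℝ (⊤ : ℕ∞) f

/-- A smooth vector field on `ℝ^D`. -/
def SmoothVF {D : ℕ} (V : (Fin D → ℝ) → Fin D → ℝ) : Prop := ∀ μ, Sm fun x => V x μ

/-- A smooth field of 2-tensors on `ℝ^D`. -/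
def Smooth2T {D : ℕ} (T : (Fin D → ℝ) → Fin D → Fin D → ℝ) : Prop :=
  ∀ μ ν, Sm fun x => T x μ ν

/-- The connection coefficients `Γ_{μν,ρ} = ½(∂_μG_{νρ} + ∂_νG_{μρ} − ∂_ρG_{μν})`. -/
def Gam {D : ℕ} (G : (Fin D → ℝ) → Fin D → Fin D → ℝ) (μ ν ρ : Fin D) (x : Fin D → ℝ) : ℝ :=
  (pd μ (fun y => G y ν ρ) x + pd ν (fun y => G y μ ρ) x - pd ρ (fun y => G y μ ν) x) / 2

/-- The torsion `H_{μνρ} = ∂_μB_{νρ} + ∂_νB_{ρμ} + ∂_ρB_{μν}`. -/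
def Htor {D : ℕ} (B : (Fin D → ℝ) → Fin D → Fin D → ℝ) (μ ν ρ : Fin D) (x : Fin D → ℝ) : ℝ :=
  pd μ (fun y => B y ν ρ) x + pd ν (fun y => B y ρ μ) x + pd ρ (fun y => B y μ ν) x

/-- `Γ⁺_{μν,ρ} = Γ_{μν,ρ} + ½H_{μνρ}`. -/
def GamP {D : ℕ} (G B : (Fin D → ℝ) → Fin D → Fin D → ℝ) (μ ν ρ : Fin D) (x : Fin D → ℝ) : ℝ :=
  Gam G μ ν ρ x + Htor B μ ν ρ x / 2

/-- `Γ⁻_{μν,ρ} = Γ_{μν,ρ} − ½H_{μνρ}`. -/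
def GamM {D : ℕ} (G B : (Fin D → ℝ) → Fin D → Fin D → ℝ) (μ ν ρ : Fin D) (x : Fin D → ℝ) : ℝ :=
  Gam G μ ν ρ x - Htor B μ ν ρ x / 2

/-- The lowered components `V_μ = G_{μν}V^ν` of a vector field. -/
def lowerV {D : ℕ} (G : (Fin D → ℝ) → Fin D → Fin D → ℝ)
    (V : (Fin D → ℝ) → Fin D → ℝ) (μ : Fin D) (x : Fin D → ℝ) : ℝ :=
  ∑ ν, G x μ ν * V x ν

/-- The covariant derivative `D⁺_μV_ν = G_{νρ}∂_μV^ρ + Γ⁺_{μρ,ν}V^ρ`. -/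
def Dp {D : ℕ} (G B : (Fin D → ℝ) → Fin D → Fin D → ℝ)
    (V : (Fin D → ℝ) → Fin D → ℝ) (μ ν : Fin D) (x : Fin D → ℝ) : ℝ :=
  (∑ ρ, G x ν ρ * pd μ (fun y => V y ρ) x) + ∑ ρ, GamP G B μ ρ ν x * V x ρ

/-- The covariant derivative `D⁻_μV_ν = G_{νρ}∂_μV^ρ + Γ⁻_{μρ,ν}V^ρ`. -/
def Dm {D : ℕ} (G B : (Fin D → ℝ) → Fin D → Fin D → ℝ)
    (V : (Fin D → ℝ) → Fin D → ℝ) (μ ν : Fin D) (x : Fin D → ℝ) : ℝ :=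
  (∑ ρ, G x ν ρ * pd μ (fun y => V y ρ) x) + ∑ ρ, GamM G B μ ρ ν x * V x ρ

/-- The Lie derivative of the metric:
`(ℒ_ζG)_{μν} = ζ^ρ∂_ρG_{μν} + ∂_μζ^ρ·G_{ρν} + ∂_νζ^ρ·G_{μρ}`. -/
def lieG {D : ℕ} (G : (Fin D → ℝ) → Fin D → Fin D → ℝ)
    (ζ : (Fin D → ℝ) → Fin D → ℝ) (μ ν : Fin D) (x : Fin D → ℝ) : ℝ :=
  (∑ ρ, ζ x ρ * pd ρ (fun y => G y μ ν) x)
    + (∑ ρ, pd μ (fun y => ζ y ρ) x * G x ρ ν)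
    + ∑ ρ, pd ν (fun y => ζ y ρ) x * G x μ ρ

/-- A Killing pair `(ζ, b)`: `D⁻_μζ_ν + D⁺_νζ_μ + ∂_μb_ν − ∂_νb_μ = 0`. -/
def IsKillingPair {D : ℕ} (G B : (Fin D → ℝ) → Fin D → Fin D → ℝ)
    (ζ b : (Fin D → ℝ) → Fin D → ℝ) : Prop :=
  ∀ (μ ν : Fin D) (x : Fin D → ℝ),
    Dm G B ζ μ ν x + Dp G B ζ ν μ x
      + pd μ (fun y => b y ν) x - pd ν (fun y => b y μ) x = 0

theorem pd_lowerV {D : ℕ} {G : (Fin D → ℝ) → Fin D → Fin D → ℝ}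
    {V : (Fin D → ℝ) → Fin D → ℝ} (hG : Smooth2T G) (hV : SmoothVF V)
    (μ ν : Fin D) (x : Fin D → ℝ) :
    pd μ (fun y => lowerV G V ν y) x
      = ∑ ρ, (G x ν ρ * pd μ (fun y => V y ρ) x + V x ρ * pd μ (fun y => G y ν ρ) x) := by
  have hG' (ρ : Fin D) : DifferentiableAt ℝ (fun y => G y ν ρ) x :=
    (hG ν ρ).differentiable (by simp) x
  have hV' (ρ : Fin D) : DifferentiableAt ℝ (fun y => V y ρ) x :=
    (hV ρ).differentiable (by simp) x
  have h := HasFDerivAt.fun_sum (u := Finset.univ)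
    fun ρ _ => (hG' ρ).hasFDerivAt.mul (hV' ρ).hasFDerivAt
  simp only [pd, lowerV]
  erw [h.fderiv]
  simp

theorem pd_neg {D : ℕ} (μ : Fin D) (f : (Fin D → ℝ) → ℝ) (x : Fin D → ℝ) :
    pd μ (fun y => -f y) x = -pd μ f x := by
  simp [pd, fderiv_fun_neg]

theorem Htor_swap_left {D : ℕ} {B : (Fin D → ℝ) → Fin D → Fin D → ℝ}
    (hB : ∀ x μ ν, B x μ ν = -B x ν μ) (μ ν ρ : Fin D) (x : Fin D → ℝ) :
    Htor B μ ν ρ x = -Htor B ν μ ρ x := by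
  have h (σ α β : Fin D) : pd σ (fun y => B y α β) x = -pd σ (fun y => B y β α) x := by
    rw [← pd_neg]
    simp only [← hB]
  simp only [Htor]
  rw [h μ ν ρ, h ν ρ μ, h ρ μ ν]
  ring

theorem Htor_swap_right {D : ℕ} {B : (Fin D → ℝ) → Fin D → Fin D → ℝ}
    (hB : ∀ x μ ν, B x μ ν = -B x ν μ) (μ ν ρ : Fin D) (x : Fin D → ℝ) :
    Htor B μ ρ ν x = -Htor B μ ν ρ x := by
  rw [Htor_swap_left hB μ ν ρ, neg_neg]
  simp only [Htor]
  ring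

theorem lieG_symm {D : ℕ} {G : (Fin D → ℝ) → Fin D → Fin D → ℝ}
    (hG : ∀ x μ ν, G x μ ν = G x ν μ) (ζ : (Fin D → ℝ) → Fin D → ℝ)
    (μ ν : Fin D) (x : Fin D → ℝ) : lieG G ζ μ ν x = lieG G ζ ν μ x := by
  simp only [lieG, hG _ ν μ, hG x ν, hG x _ μ]
  ring

/-- The lowered derivative splits into its symmetric part `½ℒ_ζG` and an antisymmetric part. -/
theorem Dp_eq {D : ℕ} {G B : (Fin D → ℝ) → Fin D → Fin D → ℝ} {ζ : (Fin D → ℝ) → Fin D → ℝ}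
    (hGs : Smooth2T G) (hGsym : ∀ x μ ν, G x μ ν = G x ν μ)
    (hB : ∀ x μ ν, B x μ ν = -B x ν μ) (hζ : SmoothVF ζ) (μ ν : Fin D) (x : Fin D → ℝ) :
    Dp G B ζ μ ν x = (lieG G ζ μ ν x
      + (pd μ (fun y => lowerV G ζ ν y) x - pd ν (fun y => lowerV G ζ μ y) x)
      - ∑ ρ, Htor B μ ν ρ x * ζ x ρ) / 2 := by
  rw [pd_lowerV hGs hζ, pd_lowerV hGs hζ, eq_div_iff two_ne_zero]
  simp only [Dp, lieG, GamP, Gam]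
  simp only [← Finset.sum_add_distrib, ← Finset.sum_sub_distrib, Finset.sum_mul]
  refine Finset.sum_congr rfl fun ρ _ => ?_
  rw [Htor_swap_right hB μ ν ρ, hGsym x ρ ν,
    show (fun y => G y ρ ν) = fun y => G y ν ρ from funext fun y => hGsym y ρ ν]
  ring

theorem Dm_eq_Dp_add {D : ℕ} {G B : (Fin D → ℝ) → Fin D → Fin D → ℝ}
    (hB : ∀ x μ ν, B x μ ν = -B x ν μ) (ζ : (Fin D → ℝ) → Fin D → ℝ)
    (μ ν : Fin D) (x : Fin D → ℝ) :
    Dm G B ζ μ ν x = Dp G B ζ μ ν x + ∑ ρ, Htor B μ ν ρ x * ζ x ρ := by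
  simp only [Dm, Dp, GamP, GamM, ← Finset.sum_add_distrib]
  refine Finset.sum_congr rfl fun ρ _ => ?_
  rw [Htor_swap_right hB μ ν ρ]
  ring

/-- Characterization of covariantly constant vector fields: `D^±_μζ_ν = 0` iff `ℒ_ζG = 0` and
`H_{μνρ}ζ^ρ = ±(∂_μζ_ν − ∂_νζ_μ)`; equivalently, iff `(ζ, ∓ζ_lowered)` is a Killing pair. -/
theorem stmt8 {D : ℕ} (hD : 1 ≤ D)
    (G B : (Fin D → ℝ) → Fin D → Fin D → ℝ)
    (hGs : Smooth2T G) (hGsym : ∀ x μ ν, G x μ ν = G x ν μ)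
    (hBs : Smooth2T B) (hBanti : ∀ x μ ν, B x μ ν = -B x ν μ)
    (ζ : (Fin D → ℝ) → Fin D → ℝ) (hζ : SmoothVF ζ) :
    ((∀ μ ν x, Dp G B ζ μ ν x = 0) ↔
       ((∀ μ ν x, lieG G ζ μ ν x = 0) ∧
        ∀ μ ν x, (∑ ρ, Htor B μ ν ρ x * ζ x ρ)
          = pd μ (fun y => lowerV G ζ ν y) x - pd ν (fun y => lowerV G ζ μ y) x)) ∧
    ((∀ μ ν x, Dm G B ζ μ ν x = 0) ↔
       ((∀ μ ν x, lieG G ζ μ ν x = 0) ∧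
        ∀ μ ν x, (∑ ρ, Htor B μ ν ρ x * ζ x ρ)
          = -(pd μ (fun y => lowerV G ζ ν y) x - pd ν (fun y => lowerV G ζ μ y) x))) ∧
    ((∀ μ ν x, Dp G B ζ μ ν x = 0) ↔
       IsKillingPair G B ζ (fun x μ => -lowerV G ζ μ x)) ∧
    ((∀ μ ν x, Dm G B ζ μ ν x = 0) ↔
       IsKillingPair G B ζ (fun x μ => lowerV G ζ μ x)) := by
  have hp := Dp_eq hGs hGsym hBanti hζ
  have hm (μ ν x) := (Dm_eq_Dp_add (G := G) hBanti ζ μ ν x).trans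
    (congrArg (· + _) (hp μ ν x))
  have hL := lieG_symm hGsym ζ
  have hH (μ ν x) : ∑ ρ, Htor B μ ν ρ x * ζ x ρ = -∑ ρ, Htor B ν μ ρ x * ζ x ρ := by
    simp only [← Finset.sum_neg_distrib, ← neg_mul, ← Htor_swap_left hBanti]
  simp only [IsKillingPair, pd_neg, hm, hp]
  refine ⟨⟨fun h => ⟨fun μ ν x => ?_, fun μ ν x => ?_⟩, fun h μ ν x => ?_⟩,
    ⟨fun h => ⟨fun μ ν x => ?_, fun μ ν x => ?_⟩, fun h μ ν x => ?_⟩,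
    ⟨fun h μ ν x => ?_, fun h μ ν x => ?_⟩, ⟨fun h μ ν x => ?_, fun h μ ν x => ?_⟩⟩
  case refine_3 | refine_6 => linarith [h.1 μ ν x, h.2 μ ν x]
  all_goals linarith [h μ ν x, h ν μ x, hL μ ν x, hH μ ν x]
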